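/- Let q > 1 and K > 0. On a probability space, let X : Ω × [0,1] → ℝ^m be a measurable process with continuous sample paths and let 𝕏 : Ω × {(s,t) : 0 ≤ s ≤ t ≤ 1} → ℝ^{m×m} be measurable, continuous in (s,t), satisfying almost surely Chen's relation 𝕏_{s,u} = 𝕏_{s,t} + 𝕏_{t,u} + (X_t − X_s) ⊗ (X_u − X_t) for all 0 ≤ s ≤ t ≤ u ≤ 1. Assume the moment bounds ‖X_t − X_s‖_{L^{2q}} ≤ K |t − s|^{1/2} and ‖𝕏_{s,t}‖_{L^{q}} ≤ K |t − s| for all 0 ≤ s ≤ t ≤ 1. Then: (i) for every p ∈ (2,3), E[(‖X‖_{p-var} + ‖𝕏‖_{(p/2)-var}^{1/2})^{2q}] < ∞ with a bound depending only on p, q, K; (ii) for every α ∈ (0, 1/2 − 1/(2q)), E[(sup_{s<t} |X_t − X_s|/|t−s|^{α} + sup_{s<t} (|𝕏_{s,t}|/|t−s|^{2α})^{1/2})^{2q}] < ∞ with a bound depending only on α, q, K. -/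

import Mathlib

open MeasureTheory Set
open scoped ENNReal

/-- Outer product `(a ⊗ b)_{ij} = a_i b_j` of two vectors of `ℝ^m`. -/
def outerP {m : ℕ} (a b : Fin m → ℝ) : Fin m → Fin m → ℝ :=
  fun i j => a i * b j

/-- A partition `0 = t_0 ≤ t_1 ≤ … ≤ t_k = 1` of `[0,1]`. -/
def IsPartition {k : ℕ} (t : Fin (k + 1) → ℝ) : Prop :=
  Monotone t ∧ t 0 = 0 ∧ t (Fin.last k) = 1

/-- The `r`-variation `‖Ξ‖_{r-var}` (valued in `[0,∞]`) of a two-parameter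
function `Ξ` over partitions of `[0,1]`. -/
noncomputable def pVar {E : Type*} [NormedAddCommGroup E] (r : ℝ)
    (Ξ : ℝ → ℝ → E) : ℝ≥0∞ :=
  (⨆ (k : ℕ) (t : { t : Fin (k + 1) → ℝ // IsPartition t }),
    ENNReal.ofReal (∑ i : Fin k, ‖Ξ (t.1 i.castSucc) (t.1 i.succ)‖ ^ r)) ^ (1 / r)

/-- The `α`-Hölder "norm" `sup_{0 ≤ s < t ≤ 1} ‖Ξ_{s,t}‖ / (t−s)^α` (valued in
`[0,∞]`) of a two-parameter function on `[0,1]`. -/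
noncomputable def holNorm {E : Type*} [NormedAddCommGroup E] (α : ℝ)
    (Ξ : ℝ → ℝ → E) : ℝ≥0∞ :=
  ⨆ (s : ℝ) (t : ℝ) (_ : 0 ≤ s ∧ s < t ∧ t ≤ 1),
    ENNReal.ofReal (‖Ξ s t‖ / (t - s) ^ α)

/-- The hypotheses of the Kolmogorov-type tightness criterion for level-2 rough
paths: `X` is a measurable process with continuous sample paths, `𝕏` is
measurable and continuous in `(s,t)`, Chen's relation holds almost surely, and
one has the moment bounds `‖X_t − X_s‖_{L^{2q}} ≤ K|t−s|^{1/2}`,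
`‖𝕏_{s,t}‖_{L^q} ≤ K|t−s|` on `[0,1]`. -/
def KolmogorovRPHyp (q K : ℝ) (m : ℕ) {Ω : Type*} [MeasurableSpace Ω]
    (μ : Measure Ω) (X : Ω → ℝ → Fin m → ℝ)
    (XX : Ω → ℝ → ℝ → Fin m → Fin m → ℝ) : Prop :=
  IsProbabilityMeasure μ ∧
  (∀ t : ℝ, Measurable fun ω => X ω t) ∧
  (∀ ω, Continuous (X ω)) ∧
  (∀ s t : ℝ, Measurable fun ω => XX ω s t) ∧
  (∀ ω, Continuous fun st : ℝ × ℝ => XX ω st.1 st.2) ∧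
  (∀ᵐ ω ∂μ, ∀ s t u : ℝ, 0 ≤ s → s ≤ t → t ≤ u → u ≤ 1 →
    XX ω s u = XX ω s t + XX ω t u + outerP (X ω t - X ω s) (X ω u - X ω t)) ∧
  (∀ s t : ℝ, 0 ≤ s → s ≤ t → t ≤ 1 →
    (∫⁻ ω, ENNReal.ofReal (‖X ω t - X ω s‖ ^ (2 * q)) ∂μ) ^ (1 / (2 * q)) ≤
      ENNReal.ofReal (K * (t - s) ^ ((1 : ℝ) / 2))) ∧
  (∀ s t : ℝ, 0 ≤ s → s ≤ t → t ≤ 1 →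
    (∫⁻ ω, ENNReal.ofReal (‖XX ω s t‖ ^ q) ∂μ) ^ (1 / q) ≤
      ENNReal.ofReal (K * (t - s)))


lemma weighted_tsum {ι : Type} [Countable ι] (w x : ι → ℝ≥0∞) (hw0 : ∀ i, w i ≠ 0)
    (hwt : ∀ i, w i ≠ ⊤) (ρ : ℝ) (hρ : 1 ≤ ρ) :
    (∑' i, w i * x i) ^ ρ ≤ (∑' i, w i) ^ (ρ - 1) * ∑' i, w i * x i ^ ρ := by
  rcases hρ.eq_or_lt with rfl | hρ1
  · simp
  let _ : MeasurableSpace ι := ⊤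
  have hc : (Real.conjExponent ρ).HolderConjugate ρ :=
    (Real.HolderConjugate.conjExponent hρ1).symm
  have hρ0 : 0 < ρ := by linarith
  set ρ' := Real.conjExponent ρ with hρ'
  have hρ'0 : 0 < ρ' := hc.pos
  have h := ENNReal.lintegral_mul_le_Lp_mul_Lq (Measure.count : Measure ι) hc
    (f := fun i => w i ^ (1 / ρ')) (g := fun i => w i ^ (1 / ρ) * x i)
    (measurable_from_top.aemeasurable) (measurable_from_top.aemeasurable)
  simp only [lintegral_count, Pi.mul_apply] at h
  have e1 : ∀ i, w i ^ (1 / ρ') * (w i ^ (1 / ρ) * x i) = w i * x i := by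
    intro i
    rw [← mul_assoc, ← ENNReal.rpow_add _ _ (hw0 i) (hwt i)]
    have : 1 / ρ' + 1 / ρ = 1 := by simpa using hc.inv_add_inv_eq_one
    rw [this, ENNReal.rpow_one]
  have e2 : ∀ i, (w i ^ (1 / ρ')) ^ ρ' = w i := by
    intro i
    rw [← ENNReal.rpow_mul, one_div_mul_cancel hρ'0.ne', ENNReal.rpow_one]
  have e3 : ∀ i, (w i ^ (1 / ρ) * x i) ^ ρ = w i * x i ^ ρ := by
    intro i
    rw [ENNReal.mul_rpow_of_nonneg _ _ hρ0.le, ← ENNReal.rpow_mul,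
      one_div_mul_cancel hρ0.ne', ENNReal.rpow_one]
  simp only [e1, e2, e3] at h
  have h2 := ENNReal.rpow_le_rpow h hρ0.le
  rw [ENNReal.mul_rpow_of_nonneg _ _ hρ0.le, ← ENNReal.rpow_mul, ← ENNReal.rpow_mul,
      one_div_mul_cancel hρ0.ne', ENNReal.rpow_one] at h2
  have e4 : 1 / ρ' * ρ = ρ - 1 := by
    have : 1 / ρ' + 1 / ρ = 1 := by simpa using hc.inv_add_inv_eq_one
    have h5 : 1 / ρ' = 1 - 1 / ρ := by linarith
    rw [h5]; field_simp
  rwa [e4] at h2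

lemma geom_lt_top (x : ℝ) (hx : x < 0) : ∑' j : ℕ, (2 : ℝ≥0∞) ^ (x * (j : ℝ)) < ⊤ := by
  have : ∀ j : ℕ, (2 : ℝ≥0∞) ^ (x * (j : ℝ)) = ((2 : ℝ≥0∞) ^ x) ^ j := by
    intro j; rw [ENNReal.rpow_mul, ENNReal.rpow_natCast]
  simp only [this, ENNReal.tsum_geometric]
  rw [ENNReal.inv_lt_top]
  apply tsub_pos_of_lt
  exact ENNReal.rpow_lt_one_of_one_lt_of_neg (by norm_num) hx

lemma chain_fin (F : ℝ → ℝ → ℝ≥0∞)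
    (hsub : ∀ s t u, 0 ≤ s → s ≤ t → t ≤ u → u ≤ 1 → F s u ≤ F s t + F t u)
    (h0 : ∀ s, 0 ≤ s → s ≤ 1 → F s s = 0) (s t : ℝ) (g : ℕ → ℝ≥0∞)
    (hg : ∀ j k : ℕ, k < 2 ^ j → s ≤ (k : ℝ) / 2 ^ j → ((k : ℝ) + 1) / 2 ^ j ≤ t →
      F ((k : ℝ) / 2 ^ j) (((k : ℝ) + 1) / 2 ^ j) ≤ g j) :
    ∀ n a b : ℕ, a ≤ b → b ≤ 2 ^ n → s ≤ (a : ℝ) / 2 ^ n → (b : ℝ) / 2 ^ n ≤ t →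
      F ((a : ℝ) / 2 ^ n) ((b : ℝ) / 2 ^ n) ≤ 2 * ∑ j ∈ Finset.range (n + 1), g j := by
  have small : ∀ n a b : ℕ, a ≤ b → b ≤ a + 1 → b ≤ 2 ^ n → s ≤ (a : ℝ) / 2 ^ n →
      (b : ℝ) / 2 ^ n ≤ t → F ((a : ℝ) / 2 ^ n) ((b : ℝ) / 2 ^ n) ≤ g n := by
    intro n a b hab hba hb hs ht
    rcases Nat.eq_or_lt_of_le hab with rfl | hlt
    · rw [h0]
      · exact zero_le
      · positivity
      · rw [div_le_one (by positivity)]; exact_mod_cast hb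
    · obtain rfl : b = a + 1 := by omega
      push_cast at ht ⊢
      exact hg n a (by omega) hs ht
  have le1 : ∀ n : ℕ, ∀ x : ℝ≥0∞, g n ≤ 2 * (x + g n) := by
    intro n x
    calc g n ≤ x + g n := le_add_self
      _ ≤ 2 * (x + g n) := le_mul_of_one_le_left zero_le (by norm_num)
  intro n
  induction n with
  | zero =>
    intro a b hab hb hs ht
    refine (small 0 a b hab ?_ hb hs ht).trans ?_
    · simp at hb; omega
    · rw [Finset.sum_range_succ]; exact le1 _ _
  | succ n ih =>
    intro a b hab hb hs ht
    rw [Finset.sum_range_succ]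
    by_cases hc : (a + 1) / 2 ≤ b / 2
    · obtain ⟨a', ha'⟩ : ∃ a', a' = (a + 1) / 2 := ⟨_, rfl⟩
      obtain ⟨b', hb'⟩ : ∃ b', b' = b / 2 := ⟨_, rfl⟩
      rw [← ha', ← hb'] at hc
      have hpos : (0 : ℝ) < 2 ^ (n + 1) := by positivity
      have hpow : 2 ^ (n + 1) = 2 * 2 ^ n := by ring
      have ea : ((2 * a' : ℕ) : ℝ) / 2 ^ (n + 1) = (a' : ℝ) / 2 ^ n := by
        push_cast; rw [pow_succ]; field_simp
      have eb : ((2 * b' : ℕ) : ℝ) / 2 ^ (n + 1) = (b' : ℝ) / 2 ^ n := by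
        push_cast; rw [pow_succ]; field_simp
      have q1 : (a : ℝ) / 2 ^ (n + 1) ≤ ((2 * a' : ℕ) : ℝ) / 2 ^ (n + 1) := by
        gcongr; omega
      have q2 : ((2 * a' : ℕ) : ℝ) / 2 ^ (n + 1) ≤ ((2 * b' : ℕ) : ℝ) / 2 ^ (n + 1) := by
        gcongr
      have q3 : ((2 * b' : ℕ) : ℝ) / 2 ^ (n + 1) ≤ (b : ℝ) / 2 ^ (n + 1) := by
        gcongr; omega
      have q4 : (b : ℝ) / 2 ^ (n + 1) ≤ 1 := by
        rw [div_le_one hpos]; exact_mod_cast hb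
      have q0 : 0 ≤ (a : ℝ) / 2 ^ (n + 1) := by positivity
      have i1 := small (n + 1) a (2 * a') (by omega) (by omega) (by omega) hs (by linarith)
      have i2 := small (n + 1) (2 * b') b (by omega) (by omega) (by omega) (by linarith) ht
      have i3 := ih a' b' hc (by omega) (by linarith) (by linarith)
      rw [← ea, ← eb] at i3
      have j1 := hsub _ _ _ q0 q1 (q2.trans q3) q4
      have j2 := hsub _ _ _ (q0.trans q1) q2 q3 q4
      calc _ ≤ _ := j1
        _ ≤ _ := add_le_add i1 (j2.trans (add_le_add i3 i2))
        _ = _ := by ring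
    · exact (small (n + 1) a b hab (by omega) hb hs ht).trans (le1 _ _)

lemma chain_lim (F : ℝ → ℝ → ℝ≥0∞)
    (hsub : ∀ s t u, 0 ≤ s → s ≤ t → t ≤ u → u ≤ 1 → F s u ≤ F s t + F t u)
    (h0 : ∀ s, 0 ≤ s → s ≤ 1 → F s s = 0)
    (hcont : Continuous fun x : ℝ × ℝ => F x.1 x.2) (s t : ℝ) (hs : 0 ≤ s) (hst : s < t)
    (ht : t ≤ 1) (g : ℕ → ℝ≥0∞)
    (hg : ∀ j k : ℕ, k < 2 ^ j → s ≤ (k : ℝ) / 2 ^ j → ((k : ℝ) + 1) / 2 ^ j ≤ t →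
      F ((k : ℝ) / 2 ^ j) (((k : ℝ) + 1) / 2 ^ j) ≤ g j) :
    F s t ≤ 2 * ∑' j, g j := by
  have hp : Filter.Tendsto (fun n : ℕ => (2 : ℝ) ^ n) Filter.atTop Filter.atTop :=
    tendsto_pow_atTop_atTop_of_one_lt (by norm_num)
  have t1 := (tendsto_nat_ceil_mul_div_atTop (R := ℝ) hs).comp hp
  have t2 := (tendsto_nat_floor_mul_div_atTop (R := ℝ) (hs.trans hst.le)).comp hp
  have t3 := (hcont.tendsto (s, t)).comp (t1.prodMk_nhds t2)
  refine le_of_tendsto t3 ?_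
  filter_upwards [t1.eventually_lt t2 hst] with n hn
  simp only [Function.comp] at hn ⊢
  have hpos : (0 : ℝ) < 2 ^ n := by positivity
  have hab : ⌈s * 2 ^ n⌉₊ ≤ ⌊t * 2 ^ n⌋₊ := by
    rw [div_lt_div_iff_of_pos_right hpos] at hn
    exact_mod_cast hn.le
  have hb : (⌊t * 2 ^ n⌋₊ : ℝ) ≤ t * 2 ^ n := Nat.floor_le (by have := hs.trans hst.le; positivity)
  refine (chain_fin F hsub h0 s t g hg n _ _ hab ?_ ?_ ?_).trans ?_
  · have : (⌊t * 2 ^ n⌋₊ : ℝ) ≤ 2 ^ n := by nlinarith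
    exact_mod_cast this
  · rw [le_div_iff₀ hpos]; exact Nat.le_ceil _
  · rw [div_le_iff₀ hpos]; exact hb
  · gcongr; exact ENNReal.sum_le_tsum _

/-- Standing deterministic assumptions on the homogeneous size function. -/
structure GoodF (F : ℝ → ℝ → ℝ≥0∞) : Prop where
  hsub : ∀ s t u, 0 ≤ s → s ≤ t → t ≤ u → u ≤ 1 → F s u ≤ F s t + F t u
  h0 : ∀ s, 0 ≤ s → s ≤ 1 → F s s = 0
  hcont : Continuous fun x : ℝ × ℝ => F x.1 x.2

/-- Value on a dyadic interval. -/
noncomputable def dyA (F : ℝ → ℝ → ℝ≥0∞) (j k : ℕ) : ℝ≥0∞ :=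
  F ((k : ℝ) / 2 ^ j) (((k : ℝ) + 1) / 2 ^ j)

/-- The dyadic interval is contained in `[s,t]`. -/
def dyIn (j k : ℕ) (s t : ℝ) : Prop := s ≤ (k : ℝ) / 2 ^ j ∧ ((k : ℝ) + 1) / 2 ^ j ≤ t

/-- Weighted dyadic sum. -/
noncomputable def dyS (F : ℝ → ℝ → ℝ≥0∞) (β r : ℝ) : ℝ≥0∞ :=
  ∑' j : ℕ, (2 : ℝ≥0∞) ^ (β * (j : ℝ)) * ∑ k : Fin (2 ^ j), dyA F j k ^ r

open Classical in
/-- Sum over dyadic intervals of level `j` in `[s,t]`. -/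
noncomputable def dyG (F : ℝ → ℝ → ℝ≥0∞) (r : ℝ) (j : ℕ) (s t : ℝ) : ℝ≥0∞ :=
  ∑ k : Fin (2 ^ j), if dyIn j k s t then dyA F j k ^ r else 0

lemma two_rpow_ne_zero (x : ℝ) : (2 : ℝ≥0∞) ^ x ≠ 0 := by
  simp [ENNReal.rpow_eq_zero_iff]

lemma two_rpow_ne_top (x : ℝ) : (2 : ℝ≥0∞) ^ x ≠ ⊤ := by
  simp [ENNReal.rpow_eq_top_iff]

lemma two_rpow_add (x y : ℝ) : (2 : ℝ≥0∞) ^ (x + y) = 2 ^ x * 2 ^ y :=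
  ENNReal.rpow_add _ _ (by norm_num) (by norm_num)

lemma A_bound (r ε : ℝ) (hr : 1 < r) (hε : 0 < ε) : ∃ C : ℝ≥0∞, C < ⊤ ∧
    ∀ F, GoodF F → ∀ s t : ℝ, 0 ≤ s → s < t → t ≤ 1 →
      F s t ^ r ≤ C * ∑' j : ℕ, (2 : ℝ≥0∞) ^ (ε * (j : ℝ)) * dyG F r j s t := by
  have hr0 : 0 < r := by linarith
  set δ := ε / (r - 1) with hδ
  have hδ0 : 0 < δ := div_pos hε (by linarith)
  have hδr : δ * (r - 1) = ε := div_mul_cancel₀ _ (by linarith)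
  refine ⟨2 ^ r * (∑' j : ℕ, (2 : ℝ≥0∞) ^ ((-δ) * (j : ℝ))) ^ (r - 1), ?_, ?_⟩
  · refine ENNReal.mul_lt_top (two_rpow_ne_top _).lt_top ?_
    exact ENNReal.rpow_lt_top_of_nonneg (by linarith) (geom_lt_top _ (by linarith)).ne
  intro F hF s t hs hst ht
  have h1 := chain_lim F hF.hsub hF.h0 hF.hcont s t hs hst ht (fun j => dyG F r j s t ^ (1 / r)) (by
    intro j k hk h1 h2
    rw [one_div, ENNReal.le_rpow_inv_iff hr0]
    have := Finset.single_le_sum (s := Finset.univ) (a := (⟨k, hk⟩ : Fin (2 ^ j)))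
      (f := fun k : Fin (2 ^ j) => @ite _ (dyIn j k s t) (Classical.propDecidable _) (dyA F j k ^ r) 0)
      (fun _ _ => zero_le) (Finset.mem_univ _)
    have hin : dyIn j k s t := ⟨h1, h2⟩
    simp only [hin, if_true] at this
    exact this)
  have h2 := ENNReal.rpow_le_rpow h1 hr0.le
  rw [ENNReal.mul_rpow_of_nonneg _ _ hr0.le] at h2
  refine h2.trans ?_
  rw [mul_assoc]
  gcongr
  have h3 := weighted_tsum (fun j : ℕ => (2 : ℝ≥0∞) ^ ((-δ) * (j : ℝ)))
    (fun j : ℕ => (2 : ℝ≥0∞) ^ (δ * (j : ℝ)) * dyG F r j s t ^ (1 / r))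
    (fun _ => two_rpow_ne_zero _) (fun _ => two_rpow_ne_top _) r hr.le
  have e1 : ∀ j : ℕ, (2 : ℝ≥0∞) ^ ((-δ) * (j : ℝ)) *
      ((2 : ℝ≥0∞) ^ (δ * (j : ℝ)) * dyG F r j s t ^ (1 / r)) = dyG F r j s t ^ (1 / r) := by
    intro j
    rw [← mul_assoc, ← two_rpow_add]
    simp
  have e2 : ∀ j : ℕ, (2 : ℝ≥0∞) ^ ((-δ) * (j : ℝ)) *
      ((2 : ℝ≥0∞) ^ (δ * (j : ℝ)) * dyG F r j s t ^ (1 / r)) ^ r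
      = (2 : ℝ≥0∞) ^ (ε * (j : ℝ)) * dyG F r j s t := by
    intro j
    rw [ENNReal.mul_rpow_of_nonneg _ _ hr0.le, ← ENNReal.rpow_mul, ← ENNReal.rpow_mul,
      one_div_mul_cancel hr0.ne', ENNReal.rpow_one, ← mul_assoc, ← two_rpow_add, ← hδr]
    congr 2; ring
  simp only [e1, e2] at h3
  exact h3

lemma pvar_bound (r ε : ℝ) (hr : 1 < r) (hε : 0 < ε) : ∃ C : ℝ≥0∞, C < ⊤ ∧
    ∀ F, GoodF F → ∀ (n : ℕ) (t : Fin (n + 1) → ℝ), IsPartition t →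
      ∑ i : Fin n, F (t i.castSucc) (t i.succ) ^ r ≤ C * dyS F ε r := by
  obtain ⟨C, hC, h⟩ := A_bound r ε hr hε
  refine ⟨C, hC, fun F hF n t ht => ?_⟩
  obtain ⟨hm, ht0, ht1⟩ := ht
  have ge0 : ∀ i, 0 ≤ t i := fun i => ht0 ▸ hm (Fin.zero_le i)
  have le1 : ∀ i, t i ≤ 1 := fun i => ht1 ▸ hm (Fin.le_last i)
  have hA : ∀ i : Fin n, F (t i.castSucc) (t i.succ) ^ r ≤
      C * ∑' j : ℕ, (2 : ℝ≥0∞) ^ (ε * (j : ℝ)) * dyG F r j (t i.castSucc) (t i.succ) := by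
    intro i
    have hle : t i.castSucc ≤ t i.succ := hm (Fin.castSucc_le_succ i)
    rcases hle.eq_or_lt with he | hlt
    · rw [← he, hF.h0 _ (ge0 _) (le1 _), ENNReal.zero_rpow_of_pos (by linarith)]
      exact zero_le
    · exact h F hF _ _ (ge0 _) hlt (le1 _)
  refine (Finset.sum_le_sum fun i _ => hA i).trans ?_
  rw [← Finset.mul_sum]
  gcongr
  rw [← Summable.tsum_finsetSum (fun _ _ => ENNReal.summable)]
  refine ENNReal.tsum_le_tsum fun j => ?_
  rw [← Finset.mul_sum]
  gcongr
  unfold dyG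
  rw [Finset.sum_comm]
  refine Finset.sum_le_sum fun k _ => ?_
  by_cases hex : ∃ i : Fin n, dyIn j k (t i.castSucc) (t i.succ)
  · obtain ⟨i, hi⟩ := hex
    rw [Finset.sum_eq_single i]
    · simp [hi]
    · intro i' _ hne
      rw [if_neg]
      intro hi'
      have hlt : ((k : ℕ) : ℝ) / 2 ^ j < (((k : ℕ) : ℝ) + 1) / 2 ^ j := by
        gcongr; linarith
      rcases lt_or_gt_of_ne hne with hl | hl
      · have : t i'.succ ≤ t i.castSucc := hm (by
          rw [Fin.le_def]; simp; exact hl)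
        have a := hi'.2; have b := hi.1
        linarith
      · have : t i.succ ≤ t i'.castSucc := hm (by
          rw [Fin.le_def]; simp; exact hl)
        have a := hi.2; have b := hi'.1
        linarith
    · simp
  · push Not at hex
    rw [Finset.sum_eq_zero]
    · exact zero_le
    · intro i _; simp [hex i]

lemma hol_bound (r ε α : ℝ) (hr : 1 < r) (hε : 0 < ε) (hα : 0 < α) : ∃ C : ℝ≥0∞, C < ⊤ ∧
    ∀ F, GoodF F → ∀ s t : ℝ, 0 ≤ s → s < t → t ≤ 1 →
      F s t ^ r ≤ ENNReal.ofReal (t - s) ^ (α * r) * (C * dyS F (ε + α * r) r) := by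
  obtain ⟨C, hC, h⟩ := A_bound r ε hr hε
  refine ⟨C, hC, fun F hF s t hs hst ht => ?_⟩
  refine (h F hF s t hs hst ht).trans ?_
  rw [mul_left_comm]
  gcongr
  unfold dyS
  rw [← ENNReal.tsum_mul_left]
  refine ENNReal.tsum_le_tsum fun j => ?_
  unfold dyG
  rw [add_mul, two_rpow_add, ← mul_assoc, mul_left_comm, mul_assoc]
  gcongr (2 : ℝ≥0∞) ^ (ε * (j : ℝ)) * ?_
  rw [Finset.mul_sum]
  refine Finset.sum_le_sum fun k _ => ?_
  split_ifs with hin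
  swap
  · exact zero_le
  refine le_mul_of_one_le_left zero_le ?_
  have hlen : (1 : ℝ) / 2 ^ j ≤ t - s := by
    have := hin.1; have h2 := hin.2
    rw [add_div] at h2
    linarith
  have e : (2 : ℝ≥0∞) ^ (α * r * (j : ℝ)) = ((2 : ℝ≥0∞) ^ j) ^ (α * r) := by
    rw [mul_comm, ENNReal.rpow_mul, ENNReal.rpow_natCast]
  rw [e, ← ENNReal.mul_rpow_of_nonneg _ _ (by have : 0 < r := by linarith
                                              positivity)]
  refine ENNReal.one_le_rpow ?_ (by have : 0 < r := by linarith
                                    positivity)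
  have e2 : (2 : ℝ≥0∞) ^ j = ENNReal.ofReal (2 ^ j) := by
    rw [ENNReal.ofReal_pow (by norm_num)]; simp
  rw [e2, ← ENNReal.ofReal_mul (by linarith), ENNReal.one_le_ofReal]
  rwa [div_le_iff₀ (by positivity)] at hlen

lemma moment_bound (q β r : ℝ) (C0 : ℝ≥0∞) (hC0 : C0 < ⊤) (hr0 : 0 < r) (hr : r ≤ 2 * q)
    (hβ : β + 1 - r / 2 < 0) : ∃ C : ℝ≥0∞, C < ⊤ ∧
    ∀ (Ω : Type) (_ : MeasurableSpace Ω) (μ : Measure Ω) (F : Ω → ℝ → ℝ → ℝ≥0∞),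
      (∀ s t, Measurable fun ω => F ω s t) →
      (∀ s t, 0 ≤ s → s ≤ t → t ≤ 1 →
        ∫⁻ ω, F ω s t ^ (2 * q) ∂μ ≤ C0 * ENNReal.ofReal (t - s) ^ q) →
      ∫⁻ ω, dyS (F ω) β r ^ (2 * q / r) ∂μ ≤ C := by
  set ρ := 2 * q / r with hρ
  have hρ1 : 1 ≤ ρ := by rw [hρ, le_div_iff₀ hr0]; linarith
  have hrρ : r * ρ = 2 * q := by rw [hρ]; field_simp
  set V := ∑' j : ℕ, (2 : ℝ≥0∞) ^ ((β + 1 - r / 2) * (j : ℝ)) with hV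
  have hVt : V < ⊤ := geom_lt_top _ hβ
  refine ⟨V ^ (ρ - 1) * (V * C0), ?_, ?_⟩
  · refine ENNReal.mul_lt_top (ENNReal.rpow_lt_top_of_nonneg (by linarith) hVt.ne)
      (ENNReal.mul_lt_top hVt hC0)
  intro Ω _ μ F hmeas hmom
  let ι := Σ j : ℕ, Fin (2 ^ j)
  let w : ι → ℝ≥0∞ := fun i => (2 : ℝ≥0∞) ^ ((β - r / 2) * (i.1 : ℝ))
  have hwV : ∀ c : ℝ≥0∞, ∑' i : ι, w i * c = V * c := by
    intro c
    rw [ENNReal.tsum_mul_right]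
    congr 1
    rw [ENNReal.tsum_sigma']
    refine tsum_congr fun j => ?_
    simp only [w, tsum_fintype, Finset.sum_const, Finset.card_univ, Fintype.card_fin, nsmul_eq_mul]
    have : ((2 ^ j : ℕ) : ℝ≥0∞) = 2 ^ (j : ℝ) := by push_cast; rw [ENNReal.rpow_natCast]
    rw [this, ← two_rpow_add]
    congr 1; ring
  have hmA : ∀ i : ι, Measurable fun ω => dyA (F ω) i.1 i.2 := fun i => hmeas _ _
  have key : ∀ ω, dyS (F ω) β r ^ ρ ≤ V ^ (ρ - 1) *
      ∑' i : ι, w i * (2 ^ (q * (i.1 : ℝ)) * dyA (F ω) i.1 i.2 ^ (2 * q)) := by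
    intro ω
    have h := weighted_tsum w
      (fun i : ι => 2 ^ (r / 2 * (i.1 : ℝ)) * dyA (F ω) i.1 i.2 ^ r)
      (fun _ => two_rpow_ne_zero _) (fun _ => two_rpow_ne_top _) ρ hρ1
    have h1 := hwV 1
    simp only [mul_one] at h1
    rw [h1] at h
    convert h using 2
    · rw [ENNReal.tsum_sigma']
      refine tsum_congr fun j => ?_
      rw [tsum_fintype, Finset.mul_sum]
      refine Finset.sum_congr rfl fun k _ => ?_
      simp only [w]
      rw [← mul_assoc, ← two_rpow_add]
      congr 2; ring
    · refine tsum_congr fun i => ?_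
      rw [ENNReal.mul_rpow_of_nonneg _ _ (by linarith), ← ENNReal.rpow_mul, ← ENNReal.rpow_mul, hrρ]
      congr 3
      have : r / 2 * (i.1 : ℝ) * ρ = (r * ρ) / 2 * i.1 := by ring
      rw [this, hrρ]; ring
  refine (lintegral_mono key).trans ?_
  rw [lintegral_const_mul]
  swap
  · refine Measurable.tsum fun i => ?_
    exact (((hmA i).pow_const _).const_mul _).const_mul _
  gcongr
  rw [lintegral_tsum (fun i => ((((hmA i).pow_const _).const_mul _).const_mul _).aemeasurable),
    ← hwV]
  refine ENNReal.tsum_le_tsum fun i => ?_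
  rw [lintegral_const_mul _ (((hmA i).pow_const _).const_mul _)]
  gcongr
  rw [lintegral_const_mul _ ((hmA i).pow_const _)]
  obtain ⟨j, k⟩ := i
  have hk : ((k : ℕ) : ℝ) + 1 ≤ 2 ^ j := by exact_mod_cast k.2
  have hm := hmom ((k : ℕ) / 2 ^ j) (((k : ℕ) + 1) / 2 ^ j) (by positivity)
    (by gcongr; linarith) (by rw [div_le_one (by positivity)]; exact hk)
  calc _ ≤ (2 : ℝ≥0∞) ^ (q * (j : ℝ)) * (C0 * ENNReal.ofReal ((((k : ℕ) : ℝ) + 1) / 2 ^ j - (k : ℕ) / 2 ^ j) ^ q) := by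
        gcongr; exact hm
    _ = C0 := by
      have e : ((((k : ℕ) : ℝ) + 1) / 2 ^ j - (k : ℕ) / 2 ^ j) = (2 ^ j)⁻¹ := by ring
      have e2 : ENNReal.ofReal (2 ^ j)⁻¹ = (2 : ℝ≥0∞) ^ (-(j : ℝ)) := by
        rw [ENNReal.ofReal_inv_of_pos (by positivity), ENNReal.ofReal_pow (by norm_num),
          ENNReal.rpow_neg, ENNReal.rpow_natCast]
        simp
      rw [e, e2, mul_left_comm, ← ENNReal.rpow_mul, ← two_rpow_add]
      have : q * (j : ℝ) + -(j : ℝ) * q = 0 := by ring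
      rw [this]; simp

lemma outerP_norm_le {m : ℕ} (a b : Fin m → ℝ) : ‖outerP a b‖ ≤ ‖a‖ * ‖b‖ := by
  rw [pi_norm_le_iff_of_nonneg (by positivity)]
  intro i
  rw [pi_norm_le_iff_of_nonneg (by positivity)]
  intro j
  simp only [outerP, norm_mul]
  exact mul_le_mul (norm_le_pi_norm a i) (norm_le_pi_norm b j) (norm_nonneg _) (norm_nonneg _)

/-- The homogeneous (subadditive) size of the rough path increment. -/
noncomputable def bigN {m : ℕ} (X : ℝ → Fin m → ℝ) (XX : ℝ → ℝ → Fin m → Fin m → ℝ)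
    (s t : ℝ) : ℝ := max ‖X t - X s‖ (√‖XX s t‖)

/-- `bigN` as an extended nonnegative number. -/
noncomputable def bigF {m : ℕ} (X : ℝ → Fin m → ℝ) (XX : ℝ → ℝ → Fin m → Fin m → ℝ)
    (s t : ℝ) : ℝ≥0∞ := ENNReal.ofReal (bigN X XX s t)

lemma bigN_nonneg {m : ℕ} (X : ℝ → Fin m → ℝ) (XX : ℝ → ℝ → Fin m → Fin m → ℝ) (s t : ℝ) :
    0 ≤ bigN X XX s t := le_max_of_le_left (norm_nonneg _)

lemma good_bigF {m : ℕ} (X : ℝ → Fin m → ℝ) (XX : ℝ → ℝ → Fin m → Fin m → ℝ)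
    (hX : Continuous X) (hXX : Continuous fun st : ℝ × ℝ => XX st.1 st.2)
    (chen : ∀ s t u : ℝ, 0 ≤ s → s ≤ t → t ≤ u → u ≤ 1 →
      XX s u = XX s t + XX t u + outerP (X t - X s) (X u - X t)) : GoodF (bigF X XX) where
  hsub := by
    intro s t u hs hst htu hu
    unfold bigF
    rw [← ENNReal.ofReal_add (bigN_nonneg _ _ _ _) (bigN_nonneg _ _ _ _)]
    apply ENNReal.ofReal_le_ofReal
    have n1 := bigN_nonneg X XX s t
    have n2 := bigN_nonneg X XX t u
    have a1 : ‖X t - X s‖ ≤ bigN X XX s t := le_max_left _ _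
    have a2 : ‖X u - X t‖ ≤ bigN X XX t u := le_max_left _ _
    have b1 : √‖XX s t‖ ≤ bigN X XX s t := le_max_right _ _
    have b2 : √‖XX t u‖ ≤ bigN X XX t u := le_max_right _ _
    rw [Real.sqrt_le_left n1] at b1
    rw [Real.sqrt_le_left n2] at b2
    refine max_le ?_ ?_
    · have : X u - X s = (X t - X s) + (X u - X t) := by abel
      rw [this]
      exact (norm_add_le _ _).trans (add_le_add a1 a2)
    · rw [Real.sqrt_le_left (by positivity), chen s t u hs hst htu hu]
      have o := outerP_norm_le (X t - X s) (X u - X t)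
      have o2 := mul_le_mul a1 a2 (norm_nonneg _) n1
      have := norm_add₃_le (a := XX s t) (b := XX t u) (c := outerP (X t - X s) (X u - X t))
      nlinarith [mul_nonneg n1 n2]
  h0 := by
    intro s hs hs1
    have h := chen s s s hs le_rfl le_rfl hs1
    have o : outerP (X s - X s) (X s - X s) = 0 := by
      ext i j; simp [outerP]
    rw [o, add_zero] at h
    have h' : XX s s = 0 := by simpa using h
    simp [bigF, bigN, h']
  hcont := by
    unfold bigF bigN
    apply ENNReal.continuous_ofReal.comp
    refine Continuous.max ?_ ?_
    · fun_prop
    · exact Real.continuous_sqrt.comp hXX.norm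

lemma sum_rpow_le_rpow_sum {ι : Type*} (S : Finset ι) (f : ι → ℝ≥0∞) (c : ℝ) (hc : 1 ≤ c) :
    ∑ i ∈ S, f i ^ c ≤ (∑ i ∈ S, f i) ^ c := by
  classical
  induction S using Finset.induction_on with
  | empty => simp
  | insert a S ha ih =>
    rw [Finset.sum_insert ha, Finset.sum_insert ha]
    exact (add_le_add le_rfl ih).trans (ENNReal.add_rpow_le_rpow_add _ _ hc)

lemma pVar_le {E : Type*} [NormedAddCommGroup E] (Ξ : ℝ → ℝ → E) (F : ℝ → ℝ → ℝ≥0∞)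
    (p r p' : ℝ) (hr : 0 < r) (hrp : r ≤ p) (hp' : 0 < p') (B : ℝ≥0∞)
    (hB : ∀ (n : ℕ) (t : Fin (n + 1) → ℝ), IsPartition t →
      ∑ i : Fin n, F (t i.castSucc) (t i.succ) ^ r ≤ B)
    (hF : ∀ s t, ENNReal.ofReal (‖Ξ s t‖ ^ p') ≤ F s t ^ p) :
    pVar p' Ξ ≤ (B ^ (p / r)) ^ (1 / p') := by
  unfold pVar
  refine ENNReal.rpow_le_rpow ?_ (by positivity)
  refine iSup_le fun n => iSup_le fun t => ?_
  rw [ENNReal.ofReal_sum_of_nonneg (fun i _ => by positivity)]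
  calc _ ≤ ∑ i : Fin n, (F (t.1 i.castSucc) (t.1 i.succ) ^ r) ^ (p / r) := by
        refine Finset.sum_le_sum fun i _ => (hF _ _).trans ?_
        rw [← ENNReal.rpow_mul, mul_div_cancel₀ _ hr.ne']
    _ ≤ _ := sum_rpow_le_rpow_sum _ _ _ (by rwa [one_le_div hr])
    _ ≤ _ := ENNReal.rpow_le_rpow (hB n t.1 t.2) (by have := hr.trans_le hrp; positivity)

lemma holNorm_le {E : Type*} [NormedAddCommGroup E] (Ξ : ℝ → ℝ → E) (F : ℝ → ℝ → ℝ≥0∞)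
    (α r c : ℝ) (hr : 0 < r) (hc : 0 < c) (B : ℝ≥0∞)
    (hB : ∀ s t : ℝ, 0 ≤ s → s < t → t ≤ 1 → F s t ^ r ≤ ENNReal.ofReal (t - s) ^ (α * r) * B)
    (hF : ∀ s t, ENNReal.ofReal ‖Ξ s t‖ ≤ F s t ^ c) :
    holNorm (c * α) Ξ ≤ (B ^ (1 / r)) ^ c := by
  unfold holNorm
  refine iSup_le fun s => iSup_le fun t => iSup_le fun ⟨hs, hst, ht⟩ => ?_
  have hts : 0 < t - s := by linarith
  rw [ENNReal.ofReal_div_of_pos (by positivity)]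
  refine ENNReal.div_le_of_le_mul ((hF s t).trans ?_)
  rw [← ENNReal.ofReal_rpow_of_pos hts, mul_comm c α, ENNReal.rpow_mul,
    ← ENNReal.mul_rpow_of_nonneg _ _ hc.le]
  refine ENNReal.rpow_le_rpow ?_ hc.le
  have h := ENNReal.rpow_le_rpow (hB s t hs hst ht) (z := 1 / r) (by positivity)
  rw [ENNReal.mul_rpow_of_nonneg _ _ (by positivity), ← ENNReal.rpow_mul, ← ENNReal.rpow_mul,
    mul_one_div_cancel hr.ne', ENNReal.rpow_one, mul_assoc, mul_one_div_cancel hr.ne', mul_one] at h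
  rwa [mul_comm]

lemma ofReal_X_le {m : ℕ} (X : ℝ → Fin m → ℝ) (XX : ℝ → ℝ → Fin m → Fin m → ℝ) (s t p : ℝ)
    (hp : 0 ≤ p) : ENNReal.ofReal (‖X t - X s‖ ^ p) ≤ bigF X XX s t ^ p := by
  unfold bigF
  rw [ENNReal.ofReal_rpow_of_nonneg (bigN_nonneg _ _ _ _) hp]
  apply ENNReal.ofReal_le_ofReal
  exact Real.rpow_le_rpow (norm_nonneg _) (le_max_left _ _) hp

lemma norm_rpow_half (x p : ℝ) (hx : 0 ≤ x) : x ^ (p / 2) = √x ^ p := by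
  rw [Real.sqrt_eq_rpow, ← Real.rpow_mul hx]; congr 1; ring

lemma ofReal_XX_le {m : ℕ} (X : ℝ → Fin m → ℝ) (XX : ℝ → ℝ → Fin m → Fin m → ℝ) (s t p : ℝ)
    (hp : 0 ≤ p) : ENNReal.ofReal (‖XX s t‖ ^ (p / 2)) ≤ bigF X XX s t ^ p := by
  unfold bigF
  rw [ENNReal.ofReal_rpow_of_nonneg (bigN_nonneg _ _ _ _) hp, norm_rpow_half _ _ (norm_nonneg _)]
  apply ENNReal.ofReal_le_ofReal
  exact Real.rpow_le_rpow (Real.sqrt_nonneg _) (le_max_right _ _) hp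

lemma bigF_le {m : ℕ} (X : ℝ → Fin m → ℝ) (XX : ℝ → ℝ → Fin m → Fin m → ℝ) (s t q : ℝ)
    (hq : 0 < q) : bigF X XX s t ^ (2 * q) ≤
      ENNReal.ofReal (‖X t - X s‖ ^ (2 * q)) + ENNReal.ofReal (‖XX s t‖ ^ q) := by
  unfold bigF bigN
  have e : ‖XX s t‖ ^ q = √‖XX s t‖ ^ (2 * q) := by
    rw [← norm_rpow_half _ _ (norm_nonneg _)]; congr 1; ring
  rw [e]
  rcases max_cases ‖X t - X s‖ (√‖XX s t‖) with ⟨h, _⟩ | ⟨h, _⟩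
  · rw [h, ENNReal.ofReal_rpow_of_nonneg (norm_nonneg _) (by positivity)]
    exact le_self_add
  · rw [h, ENNReal.ofReal_rpow_of_nonneg (Real.sqrt_nonneg _) (by positivity)]
    exact le_add_self

lemma meas_bigF {m : ℕ} {Ω : Type} [MeasurableSpace Ω] (X : Ω → ℝ → Fin m → ℝ)
    (XX : Ω → ℝ → ℝ → Fin m → Fin m → ℝ) (hX : ∀ t : ℝ, Measurable fun ω => X ω t)
    (hXX : ∀ s t : ℝ, Measurable fun ω => XX ω s t) (s t : ℝ) :
    Measurable fun ω => bigF (X ω) (XX ω) s t := by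
  unfold bigF bigN
  exact (((hX t).sub (hX s)).norm.max (hXX s t).norm.sqrt).ennreal_ofReal

/-- The moment constant of the size function. -/
noncomputable def C0 (q K : ℝ) : ℝ≥0∞ := ENNReal.ofReal K ^ (2 * q) + ENNReal.ofReal K ^ q

lemma C0_lt_top (q K : ℝ) (hq : 1 < q) : C0 q K < ⊤ :=
  ENNReal.add_lt_top.2 ⟨ENNReal.rpow_lt_top_of_nonneg (by linarith) ENNReal.ofReal_ne_top,
    ENNReal.rpow_lt_top_of_nonneg (by linarith) ENNReal.ofReal_ne_top⟩

lemma mom_bigF (q K : ℝ) (hq : 1 < q) (hK : 0 < K) {m : ℕ} {Ω : Type} [MeasurableSpace Ω]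
    (μ : Measure Ω) (X : Ω → ℝ → Fin m → ℝ)
    (XX : Ω → ℝ → ℝ → Fin m → Fin m → ℝ) (h : KolmogorovRPHyp q K m μ X XX) (s t : ℝ)
    (hs : 0 ≤ s) (hst : s ≤ t) (ht : t ≤ 1) :
    ∫⁻ ω, bigF (X ω) (XX ω) s t ^ (2 * q) ∂μ ≤ C0 q K * ENNReal.ofReal (t - s) ^ q := by
  obtain ⟨_, mX, _, mXX, _, _, bX, bXX⟩ := h
  have hq0 : 0 < q := by linarith
  refine (lintegral_mono fun ω => bigF_le (X ω) (XX ω) s t q hq0).trans ?_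
  rw [lintegral_add_right]
  swap
  · exact ((mXX s t).norm.pow_const q).ennreal_ofReal
  unfold C0
  rw [add_mul]
  have hts : 0 ≤ t - s := by linarith
  gcongr
  · have h1 := ENNReal.rpow_le_rpow (bX s t hs hst ht) (z := 2 * q) (by positivity)
    rw [← ENNReal.rpow_mul, one_div_mul_cancel (by positivity), ENNReal.rpow_one,
      ENNReal.ofReal_mul hK.le, ENNReal.mul_rpow_of_nonneg _ _ (by positivity),
      ← ENNReal.ofReal_rpow_of_nonneg hts (by positivity), ← ENNReal.rpow_mul] at h1
    have e : (1 : ℝ) / 2 * (2 * q) = q := by ring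
    rwa [e] at h1
  · have h1 := ENNReal.rpow_le_rpow (bXX s t hs hst ht) (z := q) (by positivity)
    rwa [← ENNReal.rpow_mul, one_div_mul_cancel (by positivity), ENNReal.rpow_one,
      ENNReal.ofReal_mul hK.le, ENNReal.mul_rpow_of_nonneg _ _ (by positivity)] at h1

lemma final_bound {Ω : Type} [MeasurableSpace Ω] (μ : Measure Ω) (Y₁ Y₂ S : Ω → ℝ≥0∞)
    (q r : ℝ) (hq : 1 < q) (hr : 0 < r) (C C₁ : ℝ≥0∞) (hC : C < ⊤)
    (h1 : ∀ᵐ ω ∂μ, Y₁ ω ≤ (C * S ω) ^ (1 / r) ∧ Y₂ ω ≤ (C * S ω) ^ (1 / r))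
    (hS : ∫⁻ ω, S ω ^ (2 * q / r) ∂μ ≤ C₁) :
    ∫⁻ ω, (Y₁ ω + Y₂ ω) ^ (2 * q) ∂μ ≤ 2 ^ (2 * q) * C ^ (2 * q / r) * C₁ := by
  have hq0 : 0 < q := by linarith
  calc _ ≤ ∫⁻ ω, 2 ^ (2 * q) * C ^ (2 * q / r) * S ω ^ (2 * q / r) ∂μ := by
        refine lintegral_mono_ae ?_
        filter_upwards [h1] with ω ⟨ha, hb⟩
        have h2 : Y₁ ω + Y₂ ω ≤ 2 * (C * S ω) ^ (1 / r) := by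
          rw [two_mul]; exact add_le_add ha hb
        refine (ENNReal.rpow_le_rpow h2 (by positivity)).trans ?_
        rw [ENNReal.mul_rpow_of_nonneg _ _ (by positivity), ← ENNReal.rpow_mul, mul_assoc,
          ← ENNReal.mul_rpow_of_nonneg _ _ (by positivity)]
        have : 1 / r * (2 * q) = 2 * q / r := by ring
        rw [this]
    _ = 2 ^ (2 * q) * C ^ (2 * q / r) * ∫⁻ ω, S ω ^ (2 * q / r) ∂μ := by
        rw [lintegral_const_mul']
        exact ENNReal.mul_ne_top (two_rpow_ne_top _)
          (ENNReal.rpow_lt_top_of_nonneg (by positivity) hC.ne).ne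
    _ ≤ _ := by gcongr

lemma final_const (q r : ℝ) (hq : 1 < q) (hr : 0 < r) (C C₁ : ℝ≥0∞) (hC : C < ⊤) (hC₁ : C₁ < ⊤) :
    2 ^ (2 * q) * C ^ (2 * q / r) * C₁ < ⊤ := by
  have hq0 : 0 < q := by linarith
  exact ENNReal.mul_lt_top (ENNReal.mul_lt_top (two_rpow_ne_top _).lt_top
    (ENNReal.rpow_lt_top_of_nonneg (by positivity) hC.ne)) hC₁

/-- **Kolmogorov-type moment criterion for rough paths.** Under the moment
bounds with exponent `q > 1` and constant `K`, (i) for every `p ∈ (2,3)` the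
`2q`-th moment of the homogeneous `p`-variation rough path norm of `(X, 𝕏)` is
finite, with a bound depending only on `p, q, K`; (ii) for every
`α ∈ (0, 1/2 − 1/(2q))` the `2q`-th moment of the homogeneous `α`-Hölder rough
path norm is finite, with a bound depending only on `α, q, K`. -/
theorem kolmogorov_rough_path_tightness (q K : ℝ) (hq : 1 < q) (hK : 0 < K) :
    (∀ p : ℝ, 2 < p → p < 3 → ∃ C : ℝ≥0∞, C < ⊤ ∧
      ∀ (m : ℕ) (Ω : Type) (_ : MeasurableSpace Ω) (μ : Measure Ω)
        (X : Ω → ℝ → Fin m → ℝ) (XX : Ω → ℝ → ℝ → Fin m → Fin m → ℝ),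
        KolmogorovRPHyp q K m μ X XX →
          ∫⁻ ω, (pVar p (fun s t => X ω t - X ω s) +
              (pVar (p / 2) (XX ω)) ^ ((1 : ℝ) / 2)) ^ (2 * q) ∂μ ≤ C) ∧
    (∀ α : ℝ, 0 < α → α < 1 / 2 - 1 / (2 * q) → ∃ C : ℝ≥0∞, C < ⊤ ∧
      ∀ (m : ℕ) (Ω : Type) (_ : MeasurableSpace Ω) (μ : Measure Ω)
        (X : Ω → ℝ → Fin m → ℝ) (XX : Ω → ℝ → ℝ → Fin m → Fin m → ℝ),
        KolmogorovRPHyp q K m μ X XX →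
          ∫⁻ ω, (holNorm α (fun s t => X ω t - X ω s) +
              (holNorm (2 * α) (XX ω)) ^ ((1 : ℝ) / 2)) ^ (2 * q) ∂μ ≤ C) := by
  constructor
  · intro p hp _
    set r := min p (2 * q) with hr
    have hr2 : 2 < r := lt_min hp (by linarith)
    have hrp : r ≤ p := min_le_left _ _
    have hrq : r ≤ 2 * q := min_le_right _ _
    have hr0 : 0 < r := by linarith
    have hp0 : 0 < p := by linarith
    obtain ⟨C, hC, hCb⟩ := pvar_bound r ((r / 2 - 1) / 2) (by linarith) (by linarith)
    obtain ⟨C₁, hC₁, hm⟩ := moment_bound q ((r / 2 - 1) / 2) r (C0 q K) (C0_lt_top q K hq) hr0 hrq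
      (by linarith)
    refine ⟨_, final_const q r hq hr0 C C₁ hC hC₁, ?_⟩
    intro m Ω _ μ X XX h
    refine final_bound μ _ _ (fun ω => dyS (bigF (X ω) (XX ω)) ((r / 2 - 1) / 2) r) q r hq hr0
      C C₁ hC ?_ (hm Ω _ μ (fun ω => bigF (X ω) (XX ω)) (meas_bigF X XX h.2.1 h.2.2.2.1)
        (mom_bigF q K hq hK μ X XX h))
    filter_upwards [h.2.2.2.2.2.1] with ω hω
    have hB := hCb _ (good_bigF (X ω) (XX ω) (h.2.2.1 ω) (h.2.2.2.2.1 ω) hω)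
    constructor
    · refine (pVar_le _ _ p r p hr0 hrp hp0 _ hB
        (fun s t => ofReal_X_le (X ω) (XX ω) s t p hp0.le)).trans ?_
      rw [← ENNReal.rpow_mul]
      apply le_of_eq; congr 1; field_simp
    · refine (ENNReal.rpow_le_rpow (pVar_le _ _ p r (p / 2) hr0 hrp (by positivity) _ hB
        (fun s t => ofReal_XX_le (X ω) (XX ω) s t p hp0.le)) (by norm_num)).trans ?_
      rw [← ENNReal.rpow_mul, ← ENNReal.rpow_mul]
      apply le_of_eq; congr 1; field_simp
  · intro α hα hαq
    have hq0 : 0 < q := by linarith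
    have hgap : 2 * q * α < q - 1 := by
      have := mul_lt_mul_of_pos_left hαq (show 0 < 2 * q by positivity)
      have e : 2 * q * (1 / 2 - 1 / (2 * q)) = q - 1 := by field_simp
      linarith
    set ε := (q - 1 - 2 * q * α) / 2 with hε
    have hr0 : 0 < 2 * q := by positivity
    obtain ⟨C, hC, hCb⟩ := hol_bound (2 * q) ε α (by linarith) (by linarith) hα
    obtain ⟨C₁, hC₁, hm⟩ := moment_bound q (ε + α * (2 * q)) (2 * q) (C0 q K) (C0_lt_top q K hq)
      hr0 le_rfl (by linarith)
    refine ⟨_, final_const q (2 * q) hq hr0 C C₁ hC hC₁, ?_⟩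
    intro m Ω _ μ X XX h
    refine final_bound μ _ _ (fun ω => dyS (bigF (X ω) (XX ω)) (ε + α * (2 * q)) (2 * q)) q (2 * q)
      hq hr0 C C₁ hC ?_ (hm Ω _ μ (fun ω => bigF (X ω) (XX ω)) (meas_bigF X XX h.2.1 h.2.2.2.1)
        (mom_bigF q K hq hK μ X XX h))
    filter_upwards [h.2.2.2.2.2.1] with ω hω
    have hB := hCb _ (good_bigF (X ω) (XX ω) (h.2.2.1 ω) (h.2.2.2.2.1 ω) hω)
    constructor
    · have := holNorm_le (fun s t => X ω t - X ω s) _ α (2 * q) 1 hr0 one_pos _ hB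
        (fun s t => by simpa using ofReal_X_le (X ω) (XX ω) s t 1 zero_le_one)
      rwa [one_mul, ENNReal.rpow_one] at this
    · have := holNorm_le (XX ω) _ α (2 * q) 2 hr0 two_pos _ hB
        (fun s t => by simpa using ofReal_XX_le (X ω) (XX ω) s t 2 zero_le_two)
      refine (ENNReal.rpow_le_rpow this (by norm_num)).trans ?_
      rw [← ENNReal.rpow_mul]
      norm_num
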